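/- arXiv:1912.07811 — 2 statements merged into one kernel-verified Lean document; each statement's English description precedes it below -/
import Mathlib

section
/- Let γ > 0, n ∈ ℕ, and w : Fin n → ℝ. Define the componentwise hard threshold H(w) : Fin n → ℝ by H(w)(i) = w(i) if |w(i)| > √γ and H(w)(i) = 0 otherwise. Then H(w) minimizes the functional v ↦ ‖v − w‖² + γ·‖v‖₀ over all v : Fin n → ℝ, where ‖v‖₀ denotes the number of indices i with v(i) ≠ 0 and ‖·‖ is the Euclidean norm. -/
/-- Scalar hard thresholding minimizes `a ↦ (a - w)² + γ‖a‖₀` over `ℝ`. -/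
theorem hard_threshold_scalar_minimizes {γ : ℝ} (hγ : 0 ≤ γ) (w a : ℝ) :
    ((if |w| > Real.sqrt γ then w else 0) - w) ^ 2 +
        γ * (if (if |w| > Real.sqrt γ then w else 0) ≠ 0 then 1 else 0) ≤
      (a - w) ^ 2 + γ * (if a ≠ 0 then 1 else 0) := by
  have threshold_iff : |w| > Real.sqrt γ ↔ γ < w ^ 2 := by
    rw [gt_iff_lt, ← Real.sqrt_sq_eq_abs, Real.sqrt_lt_sqrt_iff hγ]
  simp only [threshold_iff]
  split_ifs <;> simp_all <;> nlinarith [sq_nonneg (a - w)]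

/-- The squared distance plus `γ` times the `ℓ0` norm, as a sum over coordinates. -/
theorem sum_sq_sub_add_mul_card_support {ι : Type*} [Fintype ι] (γ : ℝ) (v w : ι → ℝ) :
    (∑ i, (v i - w i) ^ 2) + γ * (Finset.univ.filter fun i => v i ≠ 0).card =
      ∑ i, ((v i - w i) ^ 2 + γ * (if v i ≠ 0 then 1 else 0)) := by
  rw [Finset.sum_add_distrib, ← Finset.mul_sum, Finset.sum_boole]

open Finset in
/-- Componentwise hard thresholding minimizes `v ↦ ‖v − w‖² + γ‖v‖₀`
over `v : Fin n → ℝ`, where `‖v‖₀` is the number of nonzero entries. -/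
theorem hard_threshold_vector_minimizes (γ : ℝ) (hγ : 0 < γ) (n : ℕ) (w : Fin n → ℝ)
    (H : Fin n → ℝ) (hH : ∀ i, H i = if |w i| > Real.sqrt γ then w i else 0) :
    ∀ v : Fin n → ℝ,
      (∑ i, (H i - w i) ^ 2) + γ * (univ.filter fun i => H i ≠ 0).card ≤
        (∑ i, (v i - w i) ^ 2) + γ * (univ.filter fun i => v i ≠ 0).card := by
  intro v
  rw [sum_sq_sub_add_mul_card_support, sum_sq_sub_add_mul_card_support]
  refine sum_le_sum fun i _ => ?_
  rw [hH i]
  exact hard_threshold_scalar_minimizes hγ.le (w i) (v i)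
end

section
/- Let E, F, G be real finite-dimensional inner product spaces, A : E → G linear, W : E → F continuous linear with adjoint satisfying W* ∘ W = id, and let g ∈ G, v ∈ F, λ > 0. Then u₀ ∈ E minimizes u ↦ ½‖A u − g‖² + λ‖W u − v‖² if and only if u₀ minimizes u ↦ ½‖A u − g‖² + λ‖u − W* v‖². -/
/-- If `W* ∘ W = id`, the squared distances `‖W u - v‖ ^ 2` and `‖u - W* v‖ ^ 2` differ by a
constant independent of `u`. -/
theorem norm_map_sub_sq_of_adjoint_comp_self {E F : Type*}
    [NormedAddCommGroup E] [InnerProductSpace ℝ E] [CompleteSpace E]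
    [NormedAddCommGroup F] [InnerProductSpace ℝ F] [CompleteSpace F]
    (W : E →L[ℝ] F)
    (hW : (ContinuousLinearMap.adjoint W).comp W = ContinuousLinearMap.id ℝ E) (u : E) (v : F) :
    ‖W u - v‖ ^ 2 = ‖u - ContinuousLinearMap.adjoint W v‖ ^ 2 +
      (‖v‖ ^ 2 - ‖ContinuousLinearMap.adjoint W v‖ ^ 2) := by
  have hnorm : ‖W u‖ = ‖u‖ := W.norm_map_iff_adjoint_comp_self.mpr hW u
  rw [norm_sub_sq_real, norm_sub_sq_real, hnorm, ContinuousLinearMap.adjoint_inner_right]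
  ring

/-- With `W* ∘ W = id`, `u₀` minimizes `½‖Au − g‖² + λ‖Wu − v‖²` iff it minimizes
`½‖Au − g‖² + λ‖u − W*v‖²`. -/
theorem minimizer_equiv_tight_frame {E F G : Type*}
    [NormedAddCommGroup E] [InnerProductSpace ℝ E] [FiniteDimensional ℝ E]
    [NormedAddCommGroup F] [InnerProductSpace ℝ F] [FiniteDimensional ℝ F]
    [NormedAddCommGroup G] [InnerProductSpace ℝ G] [FiniteDimensional ℝ G]
    (A : E →ₗ[ℝ] G) (W : E →L[ℝ] F)
    (hW : (ContinuousLinearMap.adjoint W).comp W = ContinuousLinearMap.id ℝ E)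
    (g : G) (v : F) (lam : ℝ) (hlam : 0 < lam) (u₀ : E) :
    (∀ u : E,
        (1 / 2) * ‖A u₀ - g‖ ^ 2 + lam * ‖W u₀ - v‖ ^ 2 ≤
          (1 / 2) * ‖A u - g‖ ^ 2 + lam * ‖W u - v‖ ^ 2) ↔
      (∀ u : E,
        (1 / 2) * ‖A u₀ - g‖ ^ 2 + lam * ‖u₀ - ContinuousLinearMap.adjoint W v‖ ^ 2 ≤
          (1 / 2) * ‖A u - g‖ ^ 2 + lam * ‖u - ContinuousLinearMap.adjoint W v‖ ^ 2) := by
  simp only [norm_map_sub_sq_of_adjoint_comp_self W hW, mul_add, ← add_assoc,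
    add_le_add_iff_right]
end
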